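/- Let P ⊂ ℝ² be a lattice polygon with P ⊂ [0,∞)² that contains a lattice translate of 5Δ. Then for a generic polynomial f ∈ ℂ^{P∩ℤ²}, every line in the torus T satisfies exactly one of the following: (a) the intersection multiplicity of {f=0} with the line equals 1 at every common point in T (the line is transversal); (b) there is exactly one point of T at which the multiplicity is ≥ 2, and there it equals 2 (simple tangent); (c) there is exactly one point of T at which the multiplicity is ≥ 2, and there it equals 3 (simple inflection tangent); (d) there are exactly two points of T at which the multiplicity is ≥ 2, and at each it equals 2 (simple bitangent). -/

import Mathlib

open scoped Pointwise
open MvPolynomial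

noncomputable section

/-- The torus `(ℂ ∖ {0})²`. -/
def Torus : Set (ℂ × ℂ) := {p | p.1 ≠ 0 ∧ p.2 ≠ 0}

/-- Evaluation of a bivariate polynomial at a point of `ℂ²`. -/
def evalP (f : MvPolynomial (Fin 2) ℂ) (p : ℂ × ℂ) : ℂ :=
  MvPolynomial.eval (fun i => if i = 0 then p.1 else p.2) f

/-- The affine line through `p` with direction `w`, as a subset of `ℂ²`. -/
def lineThrough (p w : ℂ × ℂ) : Set (ℂ × ℂ) :=
  {q | ∃ t : ℂ, q = (p.1 + t * w.1, p.2 + t * w.2)}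

/-- The univariate polynomial `t ↦ f (p + t • w)`. -/
def lineRestrict (f : MvPolynomial (Fin 2) ℂ) (p w : ℂ × ℂ) : Polynomial ℂ :=
  MvPolynomial.aeval
    (fun i => if i = 0 then Polynomial.C p.1 + Polynomial.C w.1 * Polynomial.X
              else Polynomial.C p.2 + Polynomial.C w.2 * Polynomial.X) f

/-- Intersection multiplicity at `p` of the curve `{f = 0}` and the line through `p`
with direction `w` (as `ℕ∞`; it is `⊤` if the line lies inside the curve). -/
def interMult (f : MvPolynomial (Fin 2) ℂ) (p w : ℂ × ℂ) : ℕ∞ :=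
  if lineRestrict f p w = 0 then ⊤
  else (Polynomial.rootMultiplicity 0 (lineRestrict f p w) : ℕ∞)

/-- The point of `ℝ²` corresponding to a lattice point. -/
def rpt (k : ℤ × ℤ) : ℝ × ℝ := ((k.1 : ℝ), (k.2 : ℝ))

/-- The support of `f` is contained in `S ⊆ ℤ²`. -/
def SuppIn (f : MvPolynomial (Fin 2) ℂ) (S : Set (ℤ × ℤ)) : Prop :=
  ∀ m ∈ f.support, ((m 0 : ℤ), (m 1 : ℤ)) ∈ S

/-- The coefficient of `f` at the exponent `k ∈ ℤ²`. -/
def coeffAt (f : MvPolynomial (Fin 2) ℂ) (k : ℤ × ℤ) : ℂ :=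
  if 0 ≤ k.1 ∧ 0 ≤ k.2 then
    f.coeff (Finsupp.single (0 : Fin 2) k.1.toNat + Finsupp.single (1 : Fin 2) k.2.toNat)
  else 0

/-- A property `Q` holds for a generic polynomial supported in `S`: there is a nonzero
polynomial `D` in variables indexed by `S` such that `Q f` holds for every `f` with
support in `S` whose coefficient tuple is not annihilated by `D`. -/
def GenericOn (S : Set (ℤ × ℤ)) (Q : MvPolynomial (Fin 2) ℂ → Prop) : Prop :=
  ∃ D : MvPolynomial S ℂ, D ≠ 0 ∧
    ∀ f : MvPolynomial (Fin 2) ℂ, SuppIn f S →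
      MvPolynomial.eval (fun k => coeffAt f k.1) D ≠ 0 → Q f

/-- `P` is a lattice polygon: the convex hull of finitely many lattice points. -/
def IsLatticePolygon (P : Set (ℝ × ℝ)) : Prop :=
  ∃ V : Finset (ℤ × ℤ), V.Nonempty ∧ P = convexHull ℝ (rpt '' (V : Set (ℤ × ℤ)))

/-- The standard triangle `Δ = conv {(0,0), (1,0), (0,1)}`. -/
def stdTriangle : Set (ℝ × ℝ) := convexHull ℝ {(0, 0), (1, 0), (0, 1)}

/-- The lattice points of a subset of `ℝ²`. -/
def latticePts (P : Set (ℝ × ℝ)) : Set (ℤ × ℤ) := {k | rpt k ∈ P}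

/-- The support set (face) of `P` in the direction of the covector `γ`. -/
def face (P : Set (ℝ × ℝ)) (γ : ℤ × ℤ) : Set (ℝ × ℝ) :=
  {p ∈ P | ∀ q ∈ P, (γ.1 : ℝ) * q.1 + (γ.2 : ℝ) * q.2 ≤ (γ.1 : ℝ) * p.1 + (γ.2 : ℝ) * p.2}

/-- The lattice length of the face of `P` in direction `γ`. -/
def lenFace (P : Set (ℝ × ℝ)) (γ : ℤ × ℤ) : ℕ := (latticePts (face P γ)).ncard - 1

/-- The Euclidean area of a subset of `ℝ²`. -/
def areaOf (P : Set (ℝ × ℝ)) : ℝ := (MeasureTheory.volume P).toReal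

/-- The set of inflection points of `{f = 0}` in the torus. -/
def inflPts (f : MvPolynomial (Fin 2) ℂ) : Set (ℂ × ℂ) :=
  {p | p ∈ Torus ∧ evalP f p = 0 ∧ ∃ w : ℂ × ℂ, w ≠ 0 ∧ 3 ≤ interMult f p w}

/-- The set of lines (as subsets of `ℂ²`) tangent to `{f = 0}` at two distinct
points of the torus. -/
def bitangentLines (f : MvPolynomial (Fin 2) ℂ) : Set (Set (ℂ × ℂ)) :=
  {l | ∃ p w q₁ q₂ : ℂ × ℂ, w ≠ 0 ∧ l = lineThrough p w ∧
    q₁ ∈ lineThrough p w ∩ Torus ∧ q₂ ∈ lineThrough p w ∩ Torus ∧ q₁ ≠ q₂ ∧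
    2 ≤ interMult f q₁ w ∧ 2 ≤ interMult f q₂ w}

/-- `P` contains a lattice translate of `5Δ`. -/
def Contains5Delta (P : Set (ℝ × ℝ)) : Prop :=
  ∃ t : ℤ × ℤ, rpt t +ᵥ ((5 : ℝ) • stdTriangle) ⊆ P

/-- The line through `p` with direction `w` is transversal to `{f = 0}` in the torus. -/
def IsTransversalLine (f : MvPolynomial (Fin 2) ℂ) (p w : ℂ × ℂ) : Prop :=
  ∀ q ∈ lineThrough p w ∩ Torus, evalP f q = 0 → interMult f q w = 1

/-- The line through `p` with direction `w` is a simple tangent of `{f = 0}`. -/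
def IsSimpleTangentLine (f : MvPolynomial (Fin 2) ℂ) (p w : ℂ × ℂ) : Prop :=
  ∃ q ∈ lineThrough p w ∩ Torus, interMult f q w = 2 ∧
    ∀ q' ∈ lineThrough p w ∩ Torus, 2 ≤ interMult f q' w → q' = q

/-- The line through `p` with direction `w` is a simple inflection tangent of `{f = 0}`. -/
def IsSimpleInflTangentLine (f : MvPolynomial (Fin 2) ℂ) (p w : ℂ × ℂ) : Prop :=
  ∃ q ∈ lineThrough p w ∩ Torus, interMult f q w = 3 ∧
    ∀ q' ∈ lineThrough p w ∩ Torus, 2 ≤ interMult f q' w → q' = q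

/-- The line through `p` with direction `w` is a simple bitangent of `{f = 0}`. -/
def IsSimpleBitangentLine (f : MvPolynomial (Fin 2) ℂ) (p w : ℂ × ℂ) : Prop :=
  ∃ q₁ ∈ lineThrough p w ∩ Torus, ∃ q₂ ∈ lineThrough p w ∩ Torus, q₁ ≠ q₂ ∧
    interMult f q₁ w = 2 ∧ interMult f q₂ w = 2 ∧
    ∀ q' ∈ lineThrough p w ∩ Torus, 2 ≤ interMult f q' w → q' = q₁ ∨ q' = q₂

/-- More elements than the number of variables in a localized polynomial ring satisfy a
nontrivial algebraic relation. -/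
theorem exists_aeval_eq_zero_of_card_lt {K σ S : Type} [Field K] [Fintype σ] [Fintype S]
    (M : MvPolynomial σ K) (hM : M ≠ 0) (hc : Fintype.card σ < Fintype.card S)
    (F : S → Localization.Away M) : ∃ D : MvPolynomial S K, D ≠ 0 ∧ aeval F D = 0 := by
  by_contra! hcon
  have hind : AlgebraicIndependent K F := by
    rw [algebraicIndependent_iff]
    intro p hp
    by_contra h0
    exact hcon p h0 hp
  have hle : Submonoid.powers M ≤ nonZeroDivisors (MvPolynomial σ K) :=
    powers_le_nonZeroDivisors_of_noZeroDivisors hM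
  have : IsDomain (Localization.Away M) := IsLocalization.isDomain_localization hle
  have : FaithfulSMul (MvPolynomial σ K) (Localization.Away M) :=
    (faithfulSMul_iff_algebraMap_injective _ _).2 (IsLocalization.injective _ hle)
  have : Algebra.IsAlgebraic (MvPolynomial σ K) (Localization.Away M) :=
    IsLocalization.isAlgebraic _ (Submonoid.powers M)
  have h1 := trdeg_add_eq K (MvPolynomial σ K) (A := Localization.Away M)
  rw [trdeg_eq_zero (R := MvPolynomial σ K), add_zero, MvPolynomial.trdeg_of_isDomain] at h1
  have h2 := hind.cardinalMk_le_trdeg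
  rw [← h1] at h2
  simp at h2
  omega

namespace Polynomial

/-- A linear form that is a unit at each `t i` is invertible modulo `∏ (X - t i) ^ m i`. -/
theorem isCoprime_linear_prod_X_sub_C_pow {A ι : Type*} [CommRing A] [Fintype ι]
    (α β : A) (t : ι → A) (m : ι → ℕ) (ht : ∀ i, IsUnit (α * t i + β)) :
    IsCoprime (C α * X + C β) (∏ i, (X - C (t i)) ^ m i) := by
  refine IsCoprime.prod_right fun i _ => IsCoprime.pow_right ?_
  obtain ⟨v, hv⟩ := (ht i).exists_left_inv
  refine ⟨C v, -(C v * C α), ?_⟩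
  have h := congrArg (C : A → A[X]) hv
  simp only [map_mul, map_add, map_one] at h
  linear_combination h

/-- The low-degree part of a multiple of a monic polynomial is determined by the rest. -/
theorem coeff_modByMonic_of_dvd {A : Type*} [CommRing A] {d : ℕ} {h q : A[X]} (hh : h.Monic)
    (hd : h.degree = d) (c : Fin d → A) (hdvd : h ∣ (∑ i, C (c i) * X ^ (i : ℕ)) + q)
    (i : Fin d) : ((-q) %ₘ h).coeff i = c i := by
  obtain ⟨s, hs⟩ := hdvd
  have := (div_modByMonic_unique (f := -q) (-s) (∑ i, C (c i) * X ^ (i : ℕ)) hh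
    ⟨by linear_combination hs, by rw [hd]; exact degree_sum_fin_lt c⟩).2
  rw [this, finsetSum_coeff]
  simp only [coeff_C_mul, coeff_X_pow, Fin.val_inj, mul_ite, mul_one, mul_zero]
  simp

/-- The restriction of a bivariate polynomial to the line `y = α x + β`, as a polynomial in `x`. -/
def lineSum {A S : Type*} [CommRing A] [Fintype S] (e₁ e₂ : S → ℕ) (c : S → A) (α β : A) :
    A[X] :=
  ∑ k, C (c k) * (X ^ e₁ k * (C α * X + C β) ^ e₂ k)

theorem map_lineSum {A B S : Type*} [CommRing A] [CommRing B] [Fintype S] (φ : A →+* B)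
    (e₁ e₂ : S → ℕ) (c : S → A) (α β : A) :
    (lineSum e₁ e₂ c α β).map φ = lineSum e₁ e₂ (φ ∘ c) (φ α) (φ β) := by
  simp [lineSum, Polynomial.map_sum]

/-- If the exponents contain `d` consecutive ones on a horizontal row, then the first `d`
coefficients of a polynomial whose restriction to a line is divisible by a given polynomial of
degree `d` are determined by the others. -/
theorem coeff_modByMonic_of_dvd_lineSum {A S : Type*} [CommRing A] [Fintype S] {d : ℕ}
    {e₁ e₂ : S → ℕ} {j : Fin d → S} {a b : ℕ} (hj₁ : ∀ i, e₁ (j i) = a + i)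
    (hj₂ : ∀ i, e₂ (j i) = b) (c c' : S → A) (α β : A) {h e : A[X]} (hh : h.Monic)
    (hd : h.degree = d) (he : h ∣ e * (X ^ a * (C α * X + C β) ^ b) - 1)
    (hc' : ∀ i, c' (j i) = 0) (hcc' : ∀ k, k ∉ Set.range j → c' k = c k)
    (hdvd : h ∣ lineSum e₁ e₂ c α β) (i : Fin d) :
    ((-(e * lineSum e₁ e₂ c' α β)) %ₘ h).coeff i = c (j i) := by
  classical
  refine coeff_modByMonic_of_dvd hh hd (fun i => c (j i)) ?_ i
  have hinj : Function.Injective j := fun i i' hii => by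
    have := hj₁ i
    rw [hii, hj₁ i'] at this
    exact Fin.ext (by omega)
  have hsplit : lineSum e₁ e₂ c α β = (X ^ a * (C α * X + C β) ^ b) *
      (∑ i, C (c (j i)) * X ^ (i : ℕ)) + lineSum e₁ e₂ c' α β := by
    rw [← sub_eq_iff_eq_add]
    simp only [lineSum]
    rw [← Finset.sum_sub_distrib, Finset.mul_sum,
      ← Finset.sum_subset (Finset.subset_univ (Finset.univ.image j)),
      Finset.sum_image hinj.injOn]
    · refine Finset.sum_congr rfl fun i _ => ?_
      rw [hc', hj₁, hj₂, C_0, pow_add]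
      ring
    · intro k _ hk
      rw [hcc' k (by simpa using hk), sub_self]
  have h1 := (hdvd.mul_left e).sub (he.mul_right (∑ i, C (c (j i)) * X ^ (i : ℕ)))
  rw [hsplit] at h1
  convert h1 using 1
  ring

/-- Polynomials having prescribed contact with some line `y = α x + β` at prescribed number of
points of the torus satisfy a common algebraic relation, if the contact order is at least three
more than the number of points. -/
theorem exists_ne_zero_eval_eq_zero_of_dvd_lineSum {S : Type} [Fintype S] {n d : ℕ}
    (e₁ e₂ : S → ℕ) (j : Fin d → S) {a b : ℕ} (hj₁ : ∀ i, e₁ (j i) = a + i)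
    (hj₂ : ∀ i, e₂ (j i) = b) (m : Fin n → ℕ) (hm : ∑ i, m i = d) (hn : n + 2 < d) :
    ∃ D : MvPolynomial S ℂ, D ≠ 0 ∧ ∀ (c : S → ℂ) (α β : ℂ) (t : Fin n → ℂ),
      (∀ i, t i ≠ 0) → (∀ i, α * t i + β ≠ 0) →
      ∏ i, (X - C (t i)) ^ m i ∣ lineSum e₁ e₂ c α β → MvPolynomial.eval c D = 0 := by
  classical
  have hinj : Function.Injective j := fun i i' hii => by
    have := hj₁ i
    rw [hii, hj₁ i'] at this
    exact Fin.ext (by omega)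
  let σ := Fin n ⊕ Fin 2 ⊕ {k // k ∉ Set.range j}
  let vt : Fin n → MvPolynomial σ ℂ := fun i => MvPolynomial.X (.inl i)
  let vα : MvPolynomial σ ℂ := MvPolynomial.X (.inr (.inl 0))
  let vβ : MvPolynomial σ ℂ := MvPolynomial.X (.inr (.inl 1))
  let vc : S → MvPolynomial σ ℂ := fun k =>
    if hk : k ∈ Set.range j then 0 else MvPolynomial.X (.inr (.inr ⟨k, hk⟩))
  let M : MvPolynomial σ ℂ := ∏ i, (vt i * (vα * vt i + vβ))
  have hM : M ≠ 0 := by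
    intro h0
    have := congrArg (MvPolynomial.eval (Sum.elim (fun _ => 1)
      (Sum.elim (fun i => if i = 0 then 0 else 1) (fun _ => 0)) : σ → ℂ)) h0
    simp [M, vt, vα, vβ] at this
  have hcard : Fintype.card σ < Fintype.card S := by
    have h1 := Fintype.card_subtype_compl (fun k => k ∈ Set.range j)
    have h2 : Fintype.card {k // k ∈ Set.range j} = d := by
      exact (Fintype.card_congr (Equiv.ofInjective j hinj).symm).trans (Fintype.card_fin d)
    have h3 := Fintype.card_le_of_injective j hinj
    simp only [σ, Fintype.card_sum, Fintype.card_fin] at h3 ⊢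
    omega
  let A := Localization.Away M
  let ψ : MvPolynomial σ ℂ →+* A := algebraMap _ _
  have hunit : ∀ i, IsUnit (ψ (vt i * (vα * vt i + vβ))) := fun i =>
    isUnit_of_dvd_unit (_root_.map_dvd ψ (Finset.dvd_prod_of_mem (fun i => vt i * (vα * vt i + vβ))
      (Finset.mem_univ i)))
      (IsLocalization.Away.algebraMap_isUnit (S := A) M)
  let h : A[X] := ∏ i, (X - C (ψ (vt i))) ^ m i
  have hh : h.Monic := monic_prod_of_monic _ _ fun i _ => (monic_X_sub_C _).pow _
  obtain ⟨e, he⟩ : ∃ e : A[X], h ∣ e * (X ^ a * (C (ψ vα) * X + C (ψ vβ)) ^ b) - 1 := by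
    have h1 : IsCoprime (X : A[X]) h := by
      have := isCoprime_linear_prod_X_sub_C_pow (1 : A) 0 (fun i => ψ (vt i)) m fun i => by
        have := hunit i
        rw [map_mul] at this
        simpa using isUnit_of_mul_isUnit_left this
      simpa using this
    have h2 : IsCoprime (C (ψ vα) * X + C (ψ vβ) : A[X]) h :=
      isCoprime_linear_prod_X_sub_C_pow _ _ _ m fun i => by
        have := hunit i
        rw [map_mul] at this
        simpa using isUnit_of_mul_isUnit_right this
    obtain ⟨e, s, hes⟩ := (h1.pow_left (m := a)).mul_left (h2.pow_left (m := b))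
    exact ⟨e, -s, by linear_combination hes⟩
  let r : A[X] := (-(e * lineSum e₁ e₂ (ψ ∘ vc) (ψ vα) (ψ vβ))) %ₘ h
  let F : S → A := fun k => if k ∈ Set.range j then r.coeff (e₁ k - a) else ψ (vc k)
  obtain ⟨D, hD0, hD⟩ := exists_aeval_eq_zero_of_card_lt M hM hcard F
  refine ⟨D, hD0, fun c α β t ht hl hdvd => ?_⟩
  let y : σ → ℂ := Sum.elim t (Sum.elim ![α, β] fun k => c k)
  have hyM : IsUnit (MvPolynomial.aeval y M) := by
    simp only [M, vt, vα, vβ, y, map_prod, map_mul, map_add, MvPolynomial.aeval_X,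
      isUnit_iff_ne_zero, Finset.prod_ne_zero_iff]
    intro i _
    simpa using ⟨ht i, hl i⟩
  let φ : A →ₐ[ℂ] ℂ := IsLocalization.liftAlgHom (M := Submonoid.powers M)
    (f := MvPolynomial.aeval y) (by
      rintro ⟨_, k, rfl⟩
      simpa using hyM.pow k)
  have hφψ : ∀ p, φ (ψ p) = MvPolynomial.aeval y p := fun p => by
    simp [φ, ψ]
  have hφF : ∀ k, φ (F k) = c k := by
    intro k
    by_cases hk : k ∈ Set.range j
    · obtain ⟨i, rfl⟩ := hk
      have hhmap : h.map (φ : A →+* ℂ) = ∏ i, (X - C (t i)) ^ m i := by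
        simp only [h, Polynomial.map_prod, Polynomial.map_pow, Polynomial.map_sub, map_X, map_C,
          RingHom.coe_coe, hφψ]
        simp [vt, y]
      have hα : φ (ψ vα) = α := by rw [hφψ]; simp [vα, y]
      have hβ : φ (ψ vβ) = β := by rw [hφψ]; simp [vβ, y]
      have he' := Polynomial.map_dvd (φ : A →+* ℂ) he
      simp only [hhmap, Polynomial.map_sub, Polynomial.map_mul, Polynomial.map_pow,
        Polynomial.map_add, map_X, map_C, RingHom.coe_coe, hα, hβ, Polynomial.map_one] at he'
      have hmon : (∏ i, (X - C (t i)) ^ m i).Monic :=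
        monic_prod_of_monic _ _ fun i _ => (monic_X_sub_C _).pow _
      have hdeg : (∏ i, (X - C (t i)) ^ m i).degree = (d : WithBot ℕ) := by
        rw [Polynomial.degree_prod, ← hm]
        simp [Polynomial.degree_pow]
      have key := coeff_modByMonic_of_dvd_lineSum hj₁ hj₂ c (φ ∘ ψ ∘ vc) α β hmon hdeg he'
        (by simp [vc]) (fun k hk => by
          simp only [Function.comp_apply, hφψ]
          simp only [vc, dif_neg hk]
          simp [y]) hdvd i
      rw [← key]
      simp only [F, if_pos (Set.mem_range_self i), hj₁, Nat.add_sub_cancel_left, r]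
      rw [← hhmap, ← RingHom.coe_coe φ, ← coeff_map, map_modByMonic _ hh, Polynomial.map_neg,
        Polynomial.map_mul, map_lineSum]
      simp only [RingHom.coe_coe, hα, hβ]
    · simp only [F, if_neg hk, hφψ]
      simp only [vc, dif_neg hk]
      simp [y]
  have := congrArg φ hD
  rw [map_zero, MvPolynomial.comp_aeval_apply] at this
  simp only [hφF] at this
  rwa [MvPolynomial.aeval_def, Algebra.algebraMap_self, ← MvPolynomial.coe_eval₂Hom] at this

end Polynomial

theorem GenericOn.and {S : Set (ℤ × ℤ)} {Q R : MvPolynomial (Fin 2) ℂ → Prop}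
    (hQ : GenericOn S Q) (hR : GenericOn S R) : GenericOn S fun f => Q f ∧ R f := by
  obtain ⟨D, hD, hDQ⟩ := hQ
  obtain ⟨E, hE, hER⟩ := hR
  refine ⟨D * E, mul_ne_zero hD hE, fun f hf h => ?_⟩
  rw [map_mul] at h
  exact ⟨hDQ f hf (left_ne_zero_of_mul h), hER f hf (right_ne_zero_of_mul h)⟩

theorem GenericOn.mono {S : Set (ℤ × ℤ)} {Q R : MvPolynomial (Fin 2) ℂ → Prop}
    (hQ : GenericOn S Q) (h : ∀ f, Q f → R f) : GenericOn S R := by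
  obtain ⟨D, hD, hDQ⟩ := hQ
  exact ⟨D, hD, fun f hf hne => h f (hDQ f hf hne)⟩

theorem le_interMult_iff {f : MvPolynomial (Fin 2) ℂ} {p w : ℂ × ℂ} {m : ℕ} :
    (m : ℕ∞) ≤ interMult f p w ↔ Polynomial.X ^ m ∣ lineRestrict f p w := by
  unfold interMult
  split_ifs with h
  · simp [h]
  · rw [Nat.cast_le, Polynomial.le_rootMultiplicity_iff h, Polynomial.C_0, sub_zero]

theorem lineRestrict_comp (f : MvPolynomial (Fin 2) ℂ) (p w : ℂ × ℂ) (s r : ℂ) :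
    (lineRestrict f p w).comp (Polynomial.C s + Polynomial.C r * Polynomial.X) =
      lineRestrict f (p.1 + s * w.1, p.2 + s * w.2) (r * w.1, r * w.2) := by
  unfold lineRestrict
  induction f using MvPolynomial.induction_on with
  | C a => simp [MvPolynomial.algHom_C]
  | add f g hf hg => rw [map_add, map_add, Polynomial.add_comp, hf, hg]
  | mul_X f i hf =>
    rw [map_mul, map_mul, Polynomial.mul_comp, hf, MvPolynomial.aeval_X, MvPolynomial.aeval_X]
    congr 1
    split_ifs <;> simp <;> ring

theorem evalP_eq_eval_zero_lineRestrict (f : MvPolynomial (Fin 2) ℂ) (p w : ℂ × ℂ) :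
    evalP f p = (lineRestrict f p w).eval 0 := by
  unfold lineRestrict evalP
  induction f using MvPolynomial.induction_on with
  | C a => simp [MvPolynomial.algHom_C]
  | add f g hf hg => rw [map_add, map_add, Polynomial.eval_add, hf, hg]
  | mul_X f i hf =>
    rw [map_mul, map_mul, Polynomial.eval_mul, hf, MvPolynomial.aeval_X, MvPolynomial.eval_X]
    congr 1
    split_ifs <;> simp

theorem one_le_interMult_iff {f : MvPolynomial (Fin 2) ℂ} {p w : ℂ × ℂ} :
    1 ≤ interMult f p w ↔ evalP f p = 0 := by
  rw [← Nat.cast_one, le_interMult_iff, pow_one, evalP_eq_eval_zero_lineRestrict f p w,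
    Polynomial.X_dvd_iff, Polynomial.coeff_zero_eq_eval_zero]

/-- The restriction to a line, as a sum over a set of exponents containing the support. -/
theorem lineRestrict_eq_sum {f : MvPolynomial (Fin 2) ℂ} {S : Set (ℤ × ℤ)} [Fintype S]
    (hS : ∀ k ∈ S, 0 ≤ k.1 ∧ 0 ≤ k.2) (hf : SuppIn f S) (p w : ℂ × ℂ) :
    lineRestrict f p w = ∑ k : S, Polynomial.C (coeffAt f k.1) *
      ((Polynomial.C p.1 + Polynomial.C w.1 * Polynomial.X) ^ k.1.1.toNat *
        (Polynomial.C p.2 + Polynomial.C w.2 * Polynomial.X) ^ k.1.2.toNat) := by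
  classical
  let e : S → Fin 2 →₀ ℕ := fun k =>
    Finsupp.single (0 : Fin 2) k.1.1.toNat + Finsupp.single (1 : Fin 2) k.1.2.toNat
  have he : Function.Injective e := by
    intro k l hkl
    have h0 := DFunLike.congr_fun hkl 0
    have h1 := DFunLike.congr_fun hkl 1
    simp [e] at h0 h1
    have := hS k.1 k.2
    have := hS l.1 l.2
    refine Subtype.ext (Prod.ext ?_ ?_) <;> omega
  unfold lineRestrict
  rw [MvPolynomial.aeval_def, MvPolynomial.eval₂_eq',
    Finset.sum_subset (s₂ := Finset.univ.image e), Finset.sum_image he.injOn]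
  · refine Finset.sum_congr rfl fun k _ => ?_
    rw [coeffAt, if_pos (hS k.1 k.2)]
    simp [e]
  · intro d hd
    refine Finset.mem_image.2 ⟨⟨_, hf d hd⟩, Finset.mem_univ _, ?_⟩
    ext i
    fin_cases i <;> simp [e]
  · intro d _ hd
    rw [MvPolynomial.notMem_support_iff.1 hd, map_zero, zero_mul]

/-- Contact of order at least `m i` at distinct torus points `q i` of a common line. -/
def HasContact {n : ℕ} (m : Fin n → ℕ) (f : MvPolynomial (Fin 2) ℂ) : Prop :=
  ∃ p w : ℂ × ℂ, w ≠ 0 ∧ ∃ q : Fin n → ℂ × ℂ, Function.Injective q ∧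
    ∀ i, q i ∈ lineThrough p w ∩ Torus ∧ (m i : ℕ∞) ≤ interMult f (q i) w

theorem X_sub_C_pow_dvd_lineRestrict {f : MvPolynomial (Fin 2) ℂ} {q w : ℂ × ℂ} {m : ℕ}
    (h : (m : ℕ∞) ≤ interMult f q w) (s r : ℂ) :
    (Polynomial.X - Polynomial.C s) ^ m ∣
      lineRestrict f (q.1 - r * s * w.1, q.2 - r * s * w.2) (r * w.1, r * w.2) := by
  obtain ⟨g, hg⟩ := le_interMult_iff.1 h
  have h1 := congrArg
    (fun g => g.comp (Polynomial.C (-(r * s)) + Polynomial.C r * Polynomial.X)) hg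
  simp only [lineRestrict_comp, Polynomial.mul_comp, Polynomial.pow_comp, Polynomial.X_comp] at h1
  have h2 : Polynomial.C (-(r * s)) + Polynomial.C r * Polynomial.X =
      Polynomial.C r * (Polynomial.X - Polynomial.C s) := by
    simp only [map_neg, map_mul]
    ring
  rw [h2, mul_pow] at h1
  simp only [neg_mul, ← sub_eq_add_neg] at h1
  rw [h1]
  exact Dvd.dvd.mul_right (dvd_mul_left _ _) _

theorem prod_X_sub_C_pow_dvd {K ι : Type*} [Field K] [Fintype ι] {g : Polynomial K} {t : ι → K}
    (ht : Function.Injective t) (m : ι → ℕ)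
    (h : ∀ i, (Polynomial.X - Polynomial.C (t i)) ^ m i ∣ g) :
    ∏ i, (Polynomial.X - Polynomial.C (t i)) ^ m i ∣ g :=
  Finset.prod_dvd_of_coprime
    (fun _ _ _ _ hii => (Polynomial.pairwise_coprime_X_sub_C ht hii).pow) fun i _ => h i

theorem lineThrough_coord {p w q : ℂ × ℂ} (hq : q ∈ lineThrough p w) :
    (q.1 - p.1) * w.2 = (q.2 - p.2) * w.1 := by
  obtain ⟨t, rfl⟩ := hq
  ring

/-- A generic polynomial has no line with total contact exceeding the number of contact points
by three or more. -/
theorem genericOn_not_hasContact {S : Set (ℤ × ℤ)} (hfin : S.Finite)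
    (hS : ∀ k ∈ S, 0 ≤ k.1 ∧ 0 ≤ k.2) {n d : ℕ} {τ : ℤ × ℤ}
    (h₁ : ∀ i < d, (τ.1 + i, τ.2) ∈ S) (h₂ : ∀ i < d, (τ.1, τ.2 + i) ∈ S) (m : Fin n → ℕ)
    (hm : ∑ i, m i = d) (hn : n + 2 < d) : GenericOn S fun f => ¬HasContact m f := by
  have := hfin.fintype
  have hτ := hS _ (h₁ 0 (by omega))
  simp only [Nat.cast_zero, add_zero] at hτ
  let e₁ : S → ℕ := fun k => k.1.1.toNat
  let e₂ : S → ℕ := fun k => k.1.2.toNat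
  obtain ⟨D, hD, hDf⟩ := Polynomial.exists_ne_zero_eval_eq_zero_of_dvd_lineSum e₁ e₂
    (fun i : Fin d => ⟨_, h₁ i i.2⟩) (a := τ.1.toNat) (b := τ.2.toNat)
    (fun i => by simp only [e₁]; omega) (fun i => rfl) m hm hn
  obtain ⟨E, hE, hEf⟩ := Polynomial.exists_ne_zero_eval_eq_zero_of_dvd_lineSum e₂ e₁
    (fun i : Fin d => ⟨_, h₂ i i.2⟩) (a := τ.2.toNat) (b := τ.1.toNat)
    (fun i => by simp only [e₂]; omega) (fun i => rfl) m hm hn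
  refine ⟨D * E, mul_ne_zero hD hE, fun f hf hne => ?_⟩
  rintro ⟨p, w, hw, q, hq, hqm⟩
  rw [map_mul] at hne
  by_cases hw1 : w.1 = 0
  · have hw2 : w.2 ≠ 0 := fun h => hw (Prod.ext hw1 h)
    have hl : ∀ i, (q i).1 = w.1 / w.2 * (q i).2 + (p.1 - w.1 / w.2 * p.2) := fun i => by
      have := lineThrough_coord (hqm i).1.1
      field_simp
      linear_combination this
    refine right_ne_zero_of_mul hne (hEf _ (w.1 / w.2) (p.1 - w.1 / w.2 * p.2)
      (fun i => (q i).2) (fun i => (hqm i).1.2.2) (fun i => hl i ▸ (hqm i).1.2.1) ?_)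
    have hinj : Function.Injective fun i => (q i).2 := fun i i' hii =>
      hq (Prod.ext (by rw [hl i, hl i', show (q i).2 = (q i').2 from hii]) hii)
    have hsum : Polynomial.lineSum e₂ e₁ (fun k : S => coeffAt f k.1) (w.1 / w.2)
        (p.1 - w.1 / w.2 * p.2) =
        lineRestrict f (p.1 - w.1 / w.2 * p.2, 0) (w.1 / w.2, 1) := by
      rw [lineRestrict_eq_sum hS hf, Polynomial.lineSum]
      refine Finset.sum_congr rfl fun k _ => ?_
      simp only [map_one, map_zero, one_mul, zero_add, e₁, e₂]
      ring
    rw [hsum]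
    refine prod_X_sub_C_pow_dvd hinj m fun i => ?_
    convert X_sub_C_pow_dvd_lineRestrict (hqm i).2 (q i).2 w.2⁻¹ using 2
    · refine Prod.ext ?_ ?_
      · linear_combination -hl i
      · simp only; field_simp; ring
    · refine Prod.ext ?_ ?_ <;> simp only <;> field_simp
  · have hl : ∀ i, (q i).2 = w.2 / w.1 * (q i).1 + (p.2 - w.2 / w.1 * p.1) := fun i => by
      have := lineThrough_coord (hqm i).1.1
      field_simp
      linear_combination -this
    refine left_ne_zero_of_mul hne (hDf _ (w.2 / w.1) (p.2 - w.2 / w.1 * p.1)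
      (fun i => (q i).1) (fun i => (hqm i).1.2.1) (fun i => hl i ▸ (hqm i).1.2.2) ?_)
    have hinj : Function.Injective fun i => (q i).1 := fun i i' hii =>
      hq (Prod.ext hii (by rw [hl i, hl i', show (q i).1 = (q i').1 from hii]))
    have hsum : Polynomial.lineSum e₁ e₂ (fun k : S => coeffAt f k.1) (w.2 / w.1)
        (p.2 - w.2 / w.1 * p.1) =
        lineRestrict f (0, p.2 - w.2 / w.1 * p.1) (1, w.2 / w.1) := by
      rw [lineRestrict_eq_sum hS hf, Polynomial.lineSum]
      refine Finset.sum_congr rfl fun k _ => ?_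
      simp only [map_one, map_zero, one_mul, zero_add, e₁, e₂]
      ring
    rw [hsum]
    refine prod_X_sub_C_pow_dvd hinj m fun i => ?_
    convert X_sub_C_pow_dvd_lineRestrict (hqm i).2 (q i).1 w.1⁻¹ using 2
    · refine Prod.ext ?_ ?_
      · simp only; field_simp; ring
      · linear_combination -hl i
    · refine Prod.ext ?_ ?_ <;> simp only <;> field_simp

theorem IsLatticePolygon.finite_latticePts {P : Set (ℝ × ℝ)} (hP : IsLatticePolygon P) :
    (latticePts P).Finite := by
  obtain ⟨V, -, rfl⟩ := hP
  have hb : Bornology.IsBounded (convexHull ℝ (rpt '' (V : Set (ℤ × ℤ)))) :=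
    isBounded_convexHull.2 (V.finite_toSet.image rpt).isBounded
  obtain ⟨R, hR⟩ := hb.subset_closedBall 0
  refine (Set.finite_Icc ((-⌈R⌉, -⌈R⌉) : ℤ × ℤ) (⌈R⌉, ⌈R⌉)).subset fun k hk => ?_
  have h := hR hk
  rw [mem_closedBall_zero_iff, Prod.norm_def, max_le_iff, Real.norm_eq_abs, Real.norm_eq_abs,
    abs_le, abs_le] at h
  simp only [rpt] at h
  have hc := Int.le_ceil R
  simp only [Set.mem_Icc, Prod.le_def]
  refine ⟨⟨?_, ?_⟩, ?_, ?_⟩ <;> (rify; linarith)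

theorem Contains5Delta.exists_rows {P : Set (ℝ × ℝ)} (h5 : Contains5Delta P) :
    ∃ τ : ℤ × ℤ, ∀ i : ℕ, i < 6 →
      (τ.1 + i, τ.2) ∈ latticePts P ∧ (τ.1, τ.2 + i) ∈ latticePts P := by
  obtain ⟨τ, hτ⟩ := h5
  refine ⟨τ, fun i hi => ?_⟩
  have hi' : (i : ℝ) ≤ 5 := by exact_mod_cast Nat.lt_succ_iff.1 hi
  have hmem : ∀ v ∈ ({(0, 0), (1, 0), (0, 1)} : Set (ℝ × ℝ)),
      ((i : ℝ) / 5) • v ∈ stdTriangle := fun v hv => by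
    have h0 : ((0, 0) : ℝ × ℝ) ∈ stdTriangle := subset_convexHull ℝ _ (by simp)
    exact (convex_convexHull ℝ _).smul_mem_of_zero_mem h0 (subset_convexHull ℝ _ hv)
      ⟨by positivity, by linarith⟩
  constructor
  · have := hτ (Set.vadd_mem_vadd_set (Set.smul_mem_smul_set (hmem (1, 0) (by simp))))
    convert this using 1
    simp only [latticePts, Set.mem_ofPred_eq]
    congr! 1
    ext <;> simp [rpt]
    field_simp
  · have := hτ (Set.vadd_mem_vadd_set (Set.smul_mem_smul_set (hmem (0, 1) (by simp))))
    convert this using 1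
    simp only [latticePts, Set.mem_ofPred_eq]
    congr! 1
    ext <;> simp [rpt]
    field_simp

section LineTypes

variable {f : MvPolynomial (Fin 2) ℂ} {p w : ℂ × ℂ}

theorem IsTransversalLine.interMult_lt_two (h : IsTransversalLine f p w) {q : ℂ × ℂ}
    (hq : q ∈ lineThrough p w ∩ Torus) : ¬2 ≤ interMult f q w := fun h2 => by
  have := h q hq (one_le_interMult_iff.1 (le_trans (by norm_num) h2))
  rw [this] at h2
  exact absurd h2 (by norm_num)

theorem IsTransversalLine.not_isSimpleTangentLine (h : IsTransversalLine f p w) :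
    ¬IsSimpleTangentLine f p w := fun ⟨_, hq, hm, _⟩ => h.interMult_lt_two hq hm.ge

theorem IsTransversalLine.not_isSimpleInflTangentLine (h : IsTransversalLine f p w) :
    ¬IsSimpleInflTangentLine f p w := fun ⟨_, hq, hm, _⟩ =>
  h.interMult_lt_two hq (hm ▸ by norm_num)

theorem IsTransversalLine.not_isSimpleBitangentLine (h : IsTransversalLine f p w) :
    ¬IsSimpleBitangentLine f p w := fun ⟨_, hq, _, _, _, hm, _⟩ => h.interMult_lt_two hq hm.ge

theorem IsSimpleTangentLine.not_isSimpleInflTangentLine (h : IsSimpleTangentLine f p w) :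
    ¬IsSimpleInflTangentLine f p w := by
  obtain ⟨q, hq, hm, hu⟩ := h
  rintro ⟨q', hq', hm', -⟩
  obtain rfl := hu q' hq' (hm' ▸ by norm_num)
  rw [hm] at hm'
  exact absurd hm' (by norm_num)

theorem IsSimpleTangentLine.not_isSimpleBitangentLine (h : IsSimpleTangentLine f p w) :
    ¬IsSimpleBitangentLine f p w := by
  obtain ⟨q, hq, hm, hu⟩ := h
  rintro ⟨q₁, h₁, q₂, h₂, hne, hm₁, hm₂, -⟩
  exact hne ((hu q₁ h₁ hm₁.ge).trans (hu q₂ h₂ hm₂.ge).symm)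

theorem IsSimpleInflTangentLine.not_isSimpleBitangentLine (h : IsSimpleInflTangentLine f p w) :
    ¬IsSimpleBitangentLine f p w := by
  obtain ⟨q, hq, hm, hu⟩ := h
  rintro ⟨q₁, h₁, q₂, h₂, hne, hm₁, hm₂, -⟩
  exact hne ((hu q₁ h₁ hm₁.ge).trans (hu q₂ h₂ hm₂.ge).symm)

theorem line_type_of_not_hasContact (hw : w ≠ 0) (h4 : ¬HasContact ![4] f)
    (h32 : ¬HasContact ![3, 2] f) (h222 : ¬HasContact ![2, 2, 2] f) :
    IsTransversalLine f p w ∨ IsSimpleTangentLine f p w ∨ IsSimpleInflTangentLine f p w ∨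
      IsSimpleBitangentLine f p w := by
  have hlt : ∀ (m : ℕ) (x : ℕ∞), ¬(((m + 1 : ℕ) : ℕ∞) ≤ x) → x ≤ m := fun m x hx => by
    rw [not_le, Nat.cast_add, Nat.cast_one] at hx
    exact Order.lt_add_one_iff_of_not_isMax (by simp) |>.1 hx
  by_cases hT : IsTransversalLine f p w
  · exact Or.inl hT
  obtain ⟨q₁, hq₁, hm₁⟩ : ∃ q ∈ lineThrough p w ∩ Torus, 2 ≤ interMult f q w := by
    by_contra! hcon
    exact hT fun q hq h0 => le_antisymm (hlt 1 _ (not_le.2 (hcon q hq))) (one_le_interMult_iff.2 h0)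
  by_cases hu : ∀ q ∈ lineThrough p w ∩ Torus, 2 ≤ interMult f q w → q = q₁
  · have h3 : interMult f q₁ w ≤ 3 := hlt 3 _ fun h => h4
      ⟨p, w, hw, ![q₁], Function.injective_of_subsingleton _, fun i => by
        fin_cases i; exact ⟨hq₁, h⟩⟩
    by_cases h3' : 3 ≤ interMult f q₁ w
    · exact .inr (.inr (.inl ⟨q₁, hq₁, le_antisymm h3 h3', hu⟩))
    · exact .inr (.inl ⟨q₁, hq₁, le_antisymm (hlt 2 _ h3') hm₁, hu⟩)
  · push Not at hu
    obtain ⟨q₂, hq₂, hm₂, hne⟩ := hu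
    have key : ∀ q q' : ℂ × ℂ, q ∈ lineThrough p w ∩ Torus → q' ∈ lineThrough p w ∩ Torus →
        q ≠ q' → 2 ≤ interMult f q w → 2 ≤ interMult f q' w → interMult f q w = 2 :=
      fun q q' hq hq' hqq h h' => le_antisymm (hlt 2 _ fun h3 => h32
        ⟨p, w, hw, ![q, q'], by
          intro i j hij
          fin_cases i <;> fin_cases j <;> simp_all,
          fun i => by fin_cases i <;> [exact ⟨hq, h3⟩; exact ⟨hq', h'⟩]⟩) h
    refine .inr (.inr (.inr ⟨q₁, hq₁, q₂, hq₂, hne.symm, key _ _ hq₁ hq₂ hne.symm hm₁ hm₂,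
      key _ _ hq₂ hq₁ hne hm₂ hm₁, fun q' hq' hm' => ?_⟩))
    by_contra! hcon
    refine h222 ⟨p, w, hw, ![q₁, q₂, q'], ?_, fun i => ?_⟩
    · intro i j hij
      fin_cases i <;> fin_cases j <;> simp_all
    · fin_cases i
      exacts [⟨hq₁, hm₁⟩, ⟨hq₂, hm₂⟩, ⟨hq', hm'⟩]

end LineTypes

theorem generic_lines_are_simple (P : Set (ℝ × ℝ)) (hP : IsLatticePolygon P)
    (hpos : P ⊆ {p : ℝ × ℝ | 0 ≤ p.1 ∧ 0 ≤ p.2}) (h5 : Contains5Delta P) :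
    GenericOn (latticePts P) (fun f =>
      ∀ p w : ℂ × ℂ, w ≠ 0 →
        (IsTransversalLine f p w ∧ ¬IsSimpleTangentLine f p w ∧
          ¬IsSimpleInflTangentLine f p w ∧ ¬IsSimpleBitangentLine f p w) ∨
        (¬IsTransversalLine f p w ∧ IsSimpleTangentLine f p w ∧
          ¬IsSimpleInflTangentLine f p w ∧ ¬IsSimpleBitangentLine f p w) ∨
        (¬IsTransversalLine f p w ∧ ¬IsSimpleTangentLine f p w ∧
          IsSimpleInflTangentLine f p w ∧ ¬IsSimpleBitangentLine f p w) ∨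
        (¬IsTransversalLine f p w ∧ ¬IsSimpleTangentLine f p w ∧
          ¬IsSimpleInflTangentLine f p w ∧ IsSimpleBitangentLine f p w)) := by
  obtain ⟨τ, hτ⟩ := h5.exists_rows
  have hS : ∀ k ∈ latticePts P, 0 ≤ k.1 ∧ 0 ≤ k.2 := fun k hk => by
    simpa [rpt] using hpos hk
  have hgen : ∀ {n d : ℕ} (m : Fin n → ℕ), ∑ i, m i = d → n + 2 < d → d ≤ 6 →
      GenericOn (latticePts P) fun f => ¬HasContact m f := fun m hm hn hd =>
    genericOn_not_hasContact hP.finite_latticePts hS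
      (fun i hi => (hτ i (hi.trans_le hd)).1) (fun i hi => (hτ i (hi.trans_le hd)).2) m hm hn
  refine (((hgen ![4] rfl (by norm_num) (by norm_num)).and
    (hgen ![3, 2] rfl (by norm_num) (by norm_num))).and
    (hgen ![2, 2, 2] (d := 6) rfl (by norm_num) le_rfl)).mono ?_
  rintro f ⟨⟨h4, h32⟩, h222⟩ p w hw
  rcases line_type_of_not_hasContact (p := p) hw h4 h32 h222 with h | h | h | h
  · exact .inl ⟨h, h.not_isSimpleTangentLine, h.not_isSimpleInflTangentLine,
      h.not_isSimpleBitangentLine⟩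
  · exact .inr (.inl ⟨fun h' => h'.not_isSimpleTangentLine h, h, h.not_isSimpleInflTangentLine,
      h.not_isSimpleBitangentLine⟩)
  · exact .inr (.inr (.inl ⟨fun h' => h'.not_isSimpleInflTangentLine h,
      fun h' => h'.not_isSimpleInflTangentLine h, h, h.not_isSimpleBitangentLine⟩))
  · exact .inr (.inr (.inr ⟨fun h' => h'.not_isSimpleBitangentLine h,
      fun h' => h'.not_isSimpleBitangentLine h, fun h' => h'.not_isSimpleBitangentLine h, h⟩))

end
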